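/- arXiv:2504.00760 — 5 statements merged into one kernel-verified Lean document; each statement's English description precedes it below -/
import Mathlib

section
/- Let (A,B) be a mixed-4-separation⁺ in a 4-connected graph G. Then the following assertions are equivalent: (1) no two edges in S(A,B) share an endvertex in A \ B; (2) |A \ B| ≥ 2 or S(A,B) contains at most one edge. -/
open Set

namespace Paper

variable {V : Type*}

/-- The set of edges of `G` with one endvertex in `A \ B` and the other in `B \ A`. -/
def sepEdges (G : SimpleGraph V) (A B : Set V) : Set (Sym2 V) :=
  {e | e ∈ G.edgeSet ∧ ∃ a b : V, e = s(a, b) ∧ a ∈ A \ B ∧ b ∈ B \ A}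

/-- The order of the mixed-separation `(A, B)`: the number of vertices of `A ∩ B`
plus the number of edges between `A \ B` and `B \ A`. -/
noncomputable def sepOrder (G : SimpleGraph V) (A B : Set V) : ℕ∞ :=
  (A ∩ B).encard + (sepEdges G A B).encard

/-- A mixed-separation⁺: a pair of vertex sets covering the whole graph. -/
def IsMixedSepPlus (A B : Set V) : Prop := A ∪ B = Set.univ

/-- A (proper) mixed-separation. -/
def IsMixedSep (A B : Set V) : Prop :=
  A ∪ B = Set.univ ∧ (A \ B).Nonempty ∧ (B \ A).Nonempty

/-- `G` is `k`-connected: it has more than `k` vertices and deleting fewer than `k`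
vertices keeps it connected. -/
def KConnected (G : SimpleGraph V) (k : ℕ) : Prop :=
  (k : ℕ∞) < (Set.univ : Set V).encard ∧
    ∀ X : Set V, X.encard < (k : ℕ∞) → (G.induce (Xᶜ : Set V)).Connected

/-- Every vertex of `A ∩ B` has at least two neighbours in `A \ B`
and at least two neighbours in `B \ A`. -/
def DegreeCondition (G : SimpleGraph V) (A B : Set V) : Prop :=
  ∀ v ∈ A ∩ B,
    2 ≤ (G.neighborSet v ∩ (A \ B)).encard ∧ 2 ≤ (G.neighborSet v ∩ (B \ A)).encard

/-- No two edges in the separator of `(A,B)` share an endvertex. -/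
def MatchingCondition (G : SimpleGraph V) (A B : Set V) : Prop :=
  ∀ e ∈ sepEdges G A B, ∀ f ∈ sepEdges G A B, e ≠ f → ∀ v : V, v ∈ e → v ∉ f

/-- A tetra-separation. -/
def IsTetraSep (G : SimpleGraph V) (A B : Set V) : Prop :=
  IsMixedSep A B ∧ sepOrder G A B = 4 ∧ DegreeCondition G A B ∧ MatchingCondition G A B

/-- `(A,B) ≤ (C,D)`. -/
def LeSep (A B C D : Set V) : Prop := A ⊆ C ∧ D ⊆ B

/-- `(A,B)` and `(C,D)` are nested. -/
def Nested (A B C D : Set V) : Prop :=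
  LeSep A B C D ∨ LeSep A B D C ∨ LeSep B A C D ∨ LeSep B A D C

/-- `(A,B)` and `(C,D)` cross. -/
def Crosses (A B C D : Set V) : Prop := ¬ Nested A B C D

/-- The corner for the sides `A` and `C` of the pair `(A,B)`, `(C,D)`. -/
def corner (A B C D : Set V) : Set V := (A \ B) ∩ (C \ D)

/-- The vertex-centre of the crossing-diagram of `(A,B)` and `(C,D)`. -/
def vertexCentre (A B C D : Set V) : Set V := A ∩ B ∩ C ∩ D

/-- An edge is diagonal if its endvertices lie in opposite corners. -/
def IsDiagonal (G : SimpleGraph V) (A B C D : Set V) (e : Sym2 V) : Prop :=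
  e ∈ G.edgeSet ∧ ∃ a b : V, e = s(a, b) ∧
    ((a ∈ corner A B C D ∧ b ∈ corner B A D C) ∨
     (a ∈ corner A B D C ∧ b ∈ corner B A C D))

/-- The `C`-link of the crossing diagram of `(A,B)` and `(C,D)`: all non-diagonal
edges of `S(A,B)` with an endvertex in the corner for `AC` or for `BC`, together with
all vertices of `(C \ D) ∩ S(A,B)`.  (The `D`-link is `link G A B D C`, the `A`-link
is `link G C D A B`, the `B`-link is `link G C D B A`.) -/
def link (G : SimpleGraph V) (A B C D : Set V) : Set (V ⊕ Sym2 V) :=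
  Sum.inl '' ((C \ D) ∩ (A ∩ B)) ∪
    Sum.inr '' {e | e ∈ sepEdges G A B ∧ ¬ IsDiagonal G A B C D e ∧
      ∃ v : V, v ∈ e ∧ (v ∈ corner A B C D ∨ v ∈ corner B A C D)}

/-- The centre: the vertex-centre together with all diagonal edges. -/
def centre (G : SimpleGraph V) (A B C D : Set V) : Set (V ⊕ Sym2 V) :=
  Sum.inl '' vertexCentre A B C D ∪ Sum.inr '' {e | IsDiagonal G A B C D e}

/-- The corner-separator `L(A,C)`: the union of the `A`-link, the `C`-link, the
vertex-centre and the diagonal edges with an endvertex in the corner for `AC`. -/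
def cornerSep (G : SimpleGraph V) (A B C D : Set V) : Set (V ⊕ Sym2 V) :=
  link G C D A B ∪ link G A B C D ∪ Sum.inl '' vertexCentre A B C D ∪
    Sum.inr '' {e | IsDiagonal G A B C D e ∧ ∃ v : V, v ∈ e ∧ v ∈ corner A B C D}

/-- An edge is jumping if its endvertices lie in opposite links. -/
def IsJumping (G : SimpleGraph V) (A B C D : Set V) (e : Sym2 V) : Prop :=
  e ∈ G.edgeSet ∧ ∃ a b : V, e = s(a, b) ∧
    ((Sum.inl a ∈ link G C D A B ∧ Sum.inl b ∈ link G C D B A) ∨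
     (Sum.inl a ∈ link G A B C D ∧ Sum.inl b ∈ link G A B D C))

/-- An edge dangles from `fromLink` through `throughLink` if it has an endvertex
that is a vertex of `fromLink` and the edge itself is an element of `throughLink`. -/
def DanglesFromThrough (G : SimpleGraph V) (fromLink throughLink : Set (V ⊕ Sym2 V))
    (e : Sym2 V) : Prop :=
  e ∈ G.edgeSet ∧ (∃ v : V, v ∈ e ∧ Sum.inl v ∈ fromLink) ∧ Sum.inr e ∈ throughLink

/-- The corner for `A` and `C` is potter. -/
def Potter (G : SimpleGraph V) (A B C D : Set V) : Prop :=
  corner A B C D = ∅ ∧ (link G C D A B).encard = 2 ∧ (link G A B C D).encard = 2 ∧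
    ∃ u₁ u₂ u₃ u₄ : V, G.Adj u₁ u₂ ∧ G.Adj u₂ u₃ ∧ G.Adj u₃ u₄ ∧
      List.Nodup [u₁, u₂, u₃, u₄] ∧
      Sum.inl u₂ ∈ link G A B C D ∧ Sum.inr (s(u₁, u₂)) ∈ link G C D A B ∧
      Sum.inl u₃ ∈ link G C D A B ∧ Sum.inr (s(u₃, u₄)) ∈ link G A B C D

/-- All four links have size two and the centre is empty. -/
def LinksTwoCentreEmpty (G : SimpleGraph V) (A B C D : Set V) : Prop :=
  (link G C D A B).encard = 2 ∧ (link G C D B A).encard = 2 ∧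
    (link G A B C D).encard = 2 ∧ (link G A B D C).encard = 2 ∧
    centre G A B C D = ∅

/-- `(A,B)` is half-connected. -/
def HalfConnected (G : SimpleGraph V) (A B : Set V) : Prop :=
  (G.induce (A \ B)).Connected ∨ (G.induce (B \ A)).Connected

/-- First component of the left-reduction of `(A,B)`: delete from `A` the vertices of
`A ∩ B` with at most one neighbour in `A \ B`.  (The left-reduction of `(A,B)` is
`(leftRed G A B, B)`; the right-reduction is `(A, leftRed G B A)`.) -/
def leftRed (G : SimpleGraph V) (A B : Set V) : Set V :=
  A \ {v | v ∈ A ∩ B ∧ (G.neighborSet v ∩ (A \ B)).encard ≤ 1}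

/-- The separator of `(A,B)` as a set of vertices and edges. -/
def sepElems (G : SimpleGraph V) (A B : Set V) : Set (V ⊕ Sym2 V) :=
  Sum.inl '' (A ∩ B) ∪ Sum.inr '' sepEdges G A B

/-- `x̂`: the endvertices of an element of the separator. -/
def hat : V ⊕ Sym2 V → Set V
  | Sum.inl v => {v}
  | Sum.inr e => {w | w ∈ e}

/-- `X̂` for a set `X` of vertices and edges. -/
def hatSet (π : Set (V ⊕ Sym2 V)) : Set V := ⋃ x ∈ π, hat x

/-- Inner vertices of a walk. -/
def innerVerts (G : SimpleGraph V) {u v : V} (p : G.Walk u v) : Set V :=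
  {w | w ∈ p.support ∧ w ≠ u ∧ w ≠ v}

/-- An `X`–`Y` path: a path starting in `X`, ending in `Y`, with no other
vertex in `X ∪ Y`. -/
def IsXYPath (G : SimpleGraph V) (X Y : Set V) {u v : V} (p : G.Walk u v) : Prop :=
  p.IsPath ∧ u ∈ X ∧ v ∈ Y ∧ ∀ w ∈ p.support, w ∈ X ∪ Y → w = u ∨ w = v

/-- A walk avoids a vertex (it is not on the walk) or an edge (it is not used). -/
def WalkAvoids (G : SimpleGraph V) {u v : V} (p : G.Walk u v) (x : V ⊕ Sym2 V) : Prop :=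
  Sum.elim (fun w => w ∉ p.support) (fun e => e ∉ p.edges) x

/-- There are `n` pairwise independent `X`–`Y` paths in `G`
(no path contains an inner vertex of another). -/
def HasIndepPaths (G : SimpleGraph V) (X Y : Set V) (n : ℕ) : Prop :=
  ∃ (a b : Fin n → V) (p : ∀ i, G.Walk (a i) (b i)),
    (∀ i, IsXYPath G X Y (p i)) ∧
      ∀ i j, i ≠ j → ∀ w ∈ innerVerts G (p i), w ∉ (p j).support

/-- Maximum number of pairwise independent `X`–`Y` paths in `G`. -/
noncomputable def maxIndepPaths (G : SimpleGraph V) (X Y : Set V) : ℕ∞ :=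
  sSup {n : ℕ∞ | ∃ m : ℕ, n = (m : ℕ∞) ∧ HasIndepPaths G X Y m}

/-- `(A,B)` strongly separates `X` and `Y`. -/
def StronglySeparates (A B X Y : Set V) : Prop := X ⊆ A \ B ∧ Y ⊆ B \ A

/-- Minimum order of a mixed-separation of `G` strongly separating `X` and `Y`. -/
noncomputable def minSepOrder (G : SimpleGraph V) (X Y : Set V) : ℕ∞ :=
  sInf {n : ℕ∞ | ∃ A B : Set V,
    IsMixedSep A B ∧ StronglySeparates A B X Y ∧ sepOrder G A B = n}

/-- A `k`-separation: a mixed-separation of order `k` whose separator has no edges. -/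
def IsVertexSep (G : SimpleGraph V) (A B : Set V) (k : ℕ) : Prop :=
  IsMixedSep A B ∧ sepEdges G A B = ∅ ∧ sepOrder G A B = (k : ℕ∞)

/-- `G` is quasi-`k`-connected: `(k-1)`-connected and every `(k-1)`-separation has a
side whose proper part is a single vertex. -/
def QuasiConnected (G : SimpleGraph V) (k : ℕ) : Prop :=
  KConnected G (k - 1) ∧
    ∀ A B : Set V, IsVertexSep G A B (k - 1) →
      (A \ B).encard = 1 ∨ (B \ A).encard = 1

/-- `{x₁,x₂}` is 3-linked around the separator `{x₁,x₂,x₃,x₄}`. -/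
def ThreeLinkedAround (G : SimpleGraph V) (x₁ x₂ x₃ x₄ : V ⊕ Sym2 V) : Prop :=
  (∃ e : Sym2 V, x₃ = Sum.inr e) ∨ (∃ e : Sym2 V, x₄ = Sum.inr e) ∨
    (((∃ v : V, x₁ = Sum.inl v) ∨ (∃ v : V, x₂ = Sum.inl v)) ∧
      ∃ a b : V, G.Adj a b ∧ a ∈ hat x₁ ∧ b ∈ hat x₂) ∨
    (∃ (a b : Fin 3 → V) (p : ∀ i, G.Walk (a i) (b i)),
      (∀ i, IsXYPath G (hat x₁) (hat x₂) (p i) ∧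
        WalkAvoids G (p i) x₃ ∧ WalkAvoids G (p i) x₄) ∧
      ∀ i j, i ≠ j → ∀ w ∈ innerVerts G (p i), w ∉ (p j).support)

/-- `G` is 4-angry: 4-connected and every tetra-separation is crossed. -/
def FourAngry (G : SimpleGraph V) : Prop :=
  KConnected G 4 ∧
    ∀ A B : Set V, IsTetraSep G A B → ∃ C D : Set V, IsTetraSep G C D ∧ Crosses A B C D

/-- `G` is a sprinkled `K₄,ₘ`: a set `X` of four vertices, whose complement has
exactly `m` elements, is independent and completely joined to `X`
(edges inside `X` arbitrary). -/
def IsSprinkledK4m (G : SimpleGraph V) (m : ℕ∞) : Prop :=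
  ∃ X : Set V, X.encard = 4 ∧ (Xᶜ : Set V).encard = m ∧
    (∀ a b : V, a ∉ X → b ∉ X → ¬ G.Adj a b) ∧
    ∀ a : V, a ∉ X → ∀ x ∈ X, G.Adj a x

/-- In a `k`-connected graph, fewer than `k` vertices do not separate two vertices. -/
theorem KConnected.exists_adj_of_encard_lt {G : SimpleGraph V} {k : ℕ} (hG : KConnected G k)
    {X P : Set V} (hX : X.encard < k) {p q : V} (hp : p ∈ P) (hpX : p ∉ X) (hq : q ∉ P)
    (hqX : q ∉ X) : ∃ a ∈ P, a ∉ X ∧ ∃ b, b ∉ P ∧ b ∉ X ∧ G.Adj a b := by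
  obtain ⟨w⟩ := (hG.2 X hX).preconnected ⟨p, hpX⟩ ⟨q, hqX⟩
  obtain ⟨d, -, h₁, h₂⟩ := w.exists_boundary_dart {x | (x : V) ∈ P} hp hq
  exact ⟨d.fst, h₁, d.fst.2, d.snd, h₂, d.snd.2, d.adj⟩

/-- A vertex of a `k`-connected graph has at least `k` neighbours. -/
theorem KConnected.le_encard_neighborSet {G : SimpleGraph V} {k : ℕ} (hG : KConnected G k)
    (w : V) : (k : ℕ∞) ≤ (G.neighborSet w).encard := by
  by_contra! h
  obtain ⟨q, hq⟩ : ∃ q, q ∉ insert w (G.neighborSet w) := by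
    by_contra! hall
    have h₁ := hG.1
    rw [← Set.eq_univ_of_forall hall] at h₁
    exact absurd ((Set.encard_insert_le _ _).trans (Order.add_one_le_of_lt h)) h₁.not_ge
  simp only [Set.mem_insert_iff, not_or] at hq
  obtain ⟨a, ha, -, b, -, hb, hab⟩ := hG.exists_adj_of_encard_lt h (P := {w})
    (Set.mem_singleton w) (G.loopless.irrefl w) hq.1 hq.2
  rw [Set.mem_singleton_iff.1 ha] at hab
  exact hb hab

/-- If `A \ B` has at least two vertices, no two edges in the separator of a
mixed-4-separation⁺ of a 4-connected graph share an endvertex in `A \ B`. -/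
theorem not_mem_and_mem_of_two_le_encard {G : SimpleGraph V} {A B : Set V} (hG : KConnected G 4)
    (hplus : IsMixedSepPlus A B) (hord : sepOrder G A B = 4) (h2 : 2 ≤ (A \ B).encard)
    {e f : Sym2 V} (he : e ∈ sepEdges G A B) (hf : f ∈ sepEdges G A B) (hef : e ≠ f)
    {v : V} (hv : v ∈ A \ B) : ¬ (v ∈ e ∧ v ∈ f) := by
  classical
  rintro ⟨hve, hvf⟩
  have hcov : ∀ x, x ∈ A ∨ x ∈ B := fun x => by
    rw [← Set.mem_union, hplus]; trivial
  have hends : ∀ e, ∃ a b : V, e ∈ sepEdges G A B → e = s(a, b) ∧ a ∈ A \ B ∧ b ∈ B \ A := by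
    intro e
    by_cases h : e ∈ sepEdges G A B
    · obtain ⟨-, a, b, h⟩ := h
      exact ⟨a, b, fun _ => h⟩
    · exact ⟨v, v, fun h' => absurd h' h⟩
  choose a b hab using hends
  have hcard : ∀ g : Sym2 V → V,
      (insert v (A ∩ B ∪ g '' (sepEdges G A B \ {e, f}))).encard < (4 : ℕ) := by
    intro g
    have h₁ := Set.encard_sdiff_add_encard_of_subset (Set.pair_subset he hf)
    rw [Set.encard_pair hef] at h₁
    have h₂ : (insert v (A ∩ B ∪ g '' (sepEdges G A B \ {e, f}))).encard ≤
        (A ∩ B).encard + (sepEdges G A B \ {e, f}).encard + 1 :=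
      (Set.encard_insert_le _ _).trans <| by
        gcongr
        exact (Set.encard_union_le _ _).trans (by gcongr; exact Set.encard_image_le _ _)
    refine h₂.trans_lt ?_
    rw [sepOrder, ← h₁] at hord
    generalize (A ∩ B).encard = x at hord ⊢
    generalize (sepEdges G A B \ {e, f}).encard = y at hord ⊢
    induction x using ENat.recTopCoe with
    | top => simp at hord
    | coe x =>
      induction y using ENat.recTopCoe with
      | top => simp at hord
      | coe y =>
        norm_cast at hord ⊢
        omega
  have hmem_F : ∀ {x y}, x ∈ A \ B → y ∈ B \ A → G.Adj x y → x ≠ v →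
      s(x, y) ∈ sepEdges G A B \ {e, f} := by
    intro x y hx hy hxy hxv
    refine ⟨⟨hxy, x, y, rfl, hx, hy⟩, ?_⟩
    have hyv : v ≠ y := fun h => hv.2 (h ▸ hy.1)
    rintro (h | h)
    · rw [← h, Sym2.mem_iff] at hve
      exact hve.elim (Ne.symm hxv) hyv
    · rw [← h, Sym2.mem_iff] at hvf
      exact hvf.elim (Ne.symm hxv) hyv
  have hends_eq : ∀ {x y}, x ∈ A \ B → y ∈ B \ A → s(x, y) ∈ sepEdges G A B →
      a s(x, y) = x ∧ b s(x, y) = y := by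
    intro x y hx hy hxy
    obtain ⟨h, ha, hb⟩ := hab _ hxy
    rcases Sym2.eq_iff.1 h with ⟨h₁, h₂⟩ | ⟨h₁, h₂⟩
    · exact ⟨h₁.symm, h₂.symm⟩
    · exact absurd (h₁ ▸ hb.1) hx.2
  by_cases hcase : A \ B ⊆ insert v (A ∩ B ∪ a '' (sepEdges G A B \ {e, f}))
  · obtain ⟨w, hw, hwv⟩ : ∃ w ∈ A \ B, w ≠ v :=
      Set.exists_ne_of_one_lt_encard (lt_of_lt_of_le (by norm_num) h2) v
    have hle := (hG.le_encard_neighborSet w).trans <| Set.encard_le_encard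
      (t := insert v (A ∩ B ∪ (fun g => if a g = w then b g else a g) ''
        (sepEdges G A B \ {e, f}))) ?_
    · exact absurd hle (hcard _).not_ge
    intro y (hy : G.Adj w y)
    by_cases hyA : y ∈ A
    · by_cases hyB : y ∈ B
      · exact Or.inr (Or.inl ⟨hyA, hyB⟩)
      · rcases hcase ⟨hyA, hyB⟩ with h | h | ⟨g, hg, h⟩
        · exact Or.inl h
        · exact absurd h.2 hyB
        · refine Or.inr (Or.inr ⟨g, hg, ?_⟩)
          have : a g ≠ w := fun h' => hy.ne (h'.symm.trans h)
          exact (if_neg this).trans h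
    · have hyBA : y ∈ B \ A := ⟨(hcov y).resolve_left hyA, hyA⟩
      have hF := hmem_F hw hyBA hy hwv
      obtain ⟨h₁, h₂⟩ := hends_eq hw hyBA hF.1
      exact Or.inr (Or.inr ⟨_, hF, by simp only [if_pos h₁, h₂]⟩)
  · obtain ⟨w, hw, hwX⟩ := Set.not_subset.1 hcase
    have hB : ∀ {y}, y ∈ B \ A →
        y ∉ insert v (A ∩ B ∪ a '' (sepEdges G A B \ {e, f})) := by
      rintro y hy (h | h | ⟨g, hg, h⟩)
      · exact hy.2 (h ▸ hv.1)
      · exact hy.2 h.1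
      · exact hy.2 (h ▸ (hab g hg.1).2.1.1)
    have hb := (hab e he).2.2
    obtain ⟨x, hxA, hxX, y, hyA, -, hxy⟩ :=
      hG.exists_adj_of_encard_lt (hcard a) hw.1 hwX hb.2 (hB hb)
    have hxB : x ∉ B := fun h => hxX (Or.inr (Or.inl ⟨hxA, h⟩))
    have hy : y ∈ B \ A := ⟨(hcov y).resolve_left hyA, hyA⟩
    have hF := hmem_F ⟨hxA, hxB⟩ hy hxy fun h => hxX (Or.inl h)
    exact hxX (Or.inr (Or.inr ⟨_, hF, (hends_eq ⟨hxA, hxB⟩ hy hF.1).1⟩))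

/-- when no two separator edges share an endvertex in `A \ B`. -/
theorem left_matching (G : SimpleGraph V) (A B : Set V)
    (hG : KConnected G 4) (hplus : IsMixedSepPlus A B) (hord : sepOrder G A B = 4) :
    (∀ e ∈ sepEdges G A B, ∀ f ∈ sepEdges G A B, e ≠ f →
        ∀ v ∈ A \ B, ¬ (v ∈ e ∧ v ∈ f)) ↔
      (2 ≤ (A \ B).encard ∨ (sepEdges G A B).encard ≤ 1) := by
  constructor
  · intro h
    by_contra! hcon
    obtain ⟨hA, hS⟩ := hcon
    obtain ⟨e, f, he, hf, hef⟩ := Set.one_lt_encard_iff.1 hS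
    obtain ⟨-, x, y, hxy, hx, -⟩ := id he
    obtain ⟨-, x', y', hxy', hx', -⟩ := id hf
    have hA' : (A \ B).encard ≤ 1 := Order.le_of_lt_add_one (by rwa [one_add_one_eq_two])
    have hxx' : x = x' := Set.encard_le_one_iff.1 hA' x x' hx hx'
    refine h e he f hf hef x hx ⟨?_, ?_⟩
    · rw [hxy]; exact Sym2.mem_mk_left x y
    · rw [hxy', hxx']; exact Sym2.mem_mk_left x' y'
  · rintro (h | h) e he f hf hef v hv
    · exact not_mem_and_mem_of_two_le_encard hG hplus hord h he hf hef hv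
    · exact absurd (Set.encard_le_one_iff.1 h e f he hf) hef
end Paper
end

section
/- Let (A,B) be a mixed-4-separation⁺ in a 4-connected graph G such that every vertex in S(A,B) has at least 2 neighbours in A \ B. Then the following assertions are equivalent: (1) no two edges in S(A,B) share an endvertex in A \ B; (2) (A,B) is not an atomic edge-cut with |A| = 1; (3) |A \ B| ≥ 2. -/
open Set

namespace Paper

variable {V : Type*}

/-- In a `k`-connected graph, deleting fewer than `k` vertices leaves an edge between the
remainder of a vertex set and the remainder of its complement, if both are nonempty. -/
theorem KConnected.exists_adj_of_encard_lt_s10 {G : SimpleGraph V} {k : ℕ} (hG : KConnected G k)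
    {X U : Set V} (hX : X.encard < (k : ℕ∞)) (hU : (U \ X).Nonempty) (hU' : (Uᶜ \ X).Nonempty) :
    ∃ u ∈ U \ X, ∃ w ∈ Uᶜ \ X, G.Adj u w := by
  obtain ⟨u, huU, huX⟩ := hU
  obtain ⟨w, hwU, hwX⟩ := hU'
  obtain ⟨p⟩ := (hG.2 X hX).preconnected ⟨u, huX⟩ ⟨w, hwX⟩
  obtain ⟨d, -, hd₁, hd₂⟩ := p.exists_boundary_dart {x | (x : V) ∈ U} huU hwU
  exact ⟨d.fst, ⟨hd₁, d.fst.2⟩, d.snd, ⟨hd₂, d.snd.2⟩, d.adj⟩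

theorem sepEdges_exists_eq_of_mem {G : SimpleGraph V} {A B : Set V} {e : Sym2 V}
    (he : e ∈ sepEdges G A B) {v : V} (hv : v ∈ A \ B) (hve : v ∈ e) :
    ∃ b ∈ B \ A, e = s(v, b) := by
  obtain ⟨-, a, b, rfl, ha, hb⟩ := he
  rcases Sym2.mem_iff.1 hve with rfl | rfl
  · exact ⟨b, hb, rfl⟩
  · exact absurd hb.1 hv.2

theorem mk_mem_sepEdges {G : SimpleGraph V} {A B : Set V} {a b : V} (ha : a ∈ A \ B)
    (hb : b ∈ B \ A) (h : G.Adj a b) : s(a, b) ∈ sepEdges G A B :=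
  ⟨h, a, b, rfl, ha, hb⟩

/-- The endvertex in `A \ B` of an edge between `A \ B` and `B \ A` is unique, and likewise
the one in `B \ A`. -/
theorem eq_and_eq_of_mk_eq_mk {A B : Set V} {a b c d : V} (ha : a ∈ A \ B) (hd : d ∈ B \ A)
    (h : s(a, b) = s(c, d)) : a = c ∧ b = d := by
  rcases Sym2.eq_iff.1 h with h | ⟨rfl, -⟩
  · exact h
  · exact absurd hd.1 ha.2

/-- In a `4`-connected graph, distinct edges in the separator of a mixed-4-separation⁺ `(A, B)`
share no endvertex in `A \ B` if `A \ B` has at least two elements. -/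
theorem sepEdges_not_share_left {G : SimpleGraph V} {A B : Set V} (hG : KConnected G 4)
    (hplus : IsMixedSepPlus A B) (hord : sepOrder G A B = 4) (hA : 2 ≤ (A \ B).encard)
    {e f : Sym2 V} (he : e ∈ sepEdges G A B) (hf : f ∈ sepEdges G A B) (hef : e ≠ f)
    {v : V} (hv : v ∈ A \ B) : ¬ (v ∈ e ∧ v ∈ f) := by
  rintro ⟨hve, hvf⟩
  obtain ⟨a, ha, rfl⟩ := sepEdges_exists_eq_of_mem he hv hve
  obtain ⟨b, hb, rfl⟩ := sepEdges_exists_eq_of_mem hf hv hvf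
  have hab : a ≠ b := by rintro rfl; exact hef rfl
  have hcover : ∀ x, x ∉ A \ B → x ∈ A ∩ B ∨ x ∈ B \ A := by
    intro x hx
    have : x ∈ A ∪ B := by rw [hplus]; trivial
    grind
  have hends : ∀ x : Sym2 V, ∃ p : V × V,
      x ∈ sepEdges G A B → x = s(p.1, p.2) ∧ p.1 ∈ A \ B ∧ p.2 ∈ B \ A := by
    intro x
    by_cases hx : x ∈ sepEdges G A B
    · obtain ⟨-, c, d, h⟩ := id hx
      exact ⟨(c, d), fun _ => h⟩
    · exact ⟨(v, v), fun h => absurd h hx⟩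
  choose p hp using hends
  have hp_mk : ∀ {c d : V}, c ∈ A \ B → d ∈ B \ A → G.Adj c d → p s(c, d) = (c, d) := by
    intro c d hc hd h
    obtain ⟨h₁, -, h₂⟩ := hp _ (mk_mem_sepEdges hc hd h)
    obtain ⟨h₃, h₄⟩ := eq_and_eq_of_mk_eq_mk hc h₂ h₁
    exact Prod.ext h₃.symm h₄.symm
  set R := (sepEdges G A B \ {s(v, a)}) \ {s(v, b)} with hR
  have hRcard : R.encard + 1 + 1 = (sepEdges G A B).encard := by
    rw [hR, encard_sdiff_singleton_add_one (show s(v, b) ∈ sepEdges G A B \ {s(v, a)} from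
      ⟨hf, hef.symm⟩), encard_sdiff_singleton_add_one he]
  have hmemR : ∀ {c d : V}, c ∈ A \ B → d ∈ B \ A → G.Adj c d → c ≠ v → s(c, d) ∈ R := by
    intro c d hc hd h hcv
    refine ⟨⟨mk_mem_sepEdges hc hd h, fun h' => hcv ?_⟩, fun h' => hcv ?_⟩
    · exact (eq_and_eq_of_mk_eq_mk hc ha h').1
    · exact (eq_and_eq_of_mk_eq_mk hc hb h').1
  obtain ⟨k, r, hk, hr, hkr⟩ : ∃ k r : ℕ, (A ∩ B).encard = k ∧ R.encard = r ∧ k + r = 2 := by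
    rw [sepOrder, ← hRcard] at hord
    generalize (A ∩ B).encard = m at *
    generalize R.encard = n at *
    induction m using ENat.recTopCoe with
    | top => simp at hord
    | coe m =>
      induction n using ENat.recTopCoe with
      | top => simp at hord
      | coe n => exact ⟨m, n, rfl, rfl, by norm_cast at hord; omega⟩
  by_cases hB : ∃ w ∈ B \ A, w ∉ (fun x => (p x).2) '' R
  · obtain ⟨w, hw, hwR⟩ := hB
    have hXcard : ((A ∩ B) ∪ {v} ∪ (fun x => (p x).2) '' R).encard < ((4 : ℕ) : ℕ∞) := by
      have h₁ := encard_union_le ((A ∩ B) ∪ {v}) ((fun x => (p x).2) '' R)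
      have h₂ := encard_union_le (A ∩ B) {v}
      have h₃ := encard_image_le (fun x => (p x).2) R
      rw [encard_singleton] at h₂
      rw [hk] at h₂
      rw [hr] at h₃
      refine (h₁.trans (add_le_add h₂ h₃)).trans_lt ?_
      norm_cast
      omega
    obtain ⟨u, hu, huv⟩ : ∃ u ∈ A \ B, u ≠ v :=
      exists_ne_of_one_lt_encard (lt_of_lt_of_le (by norm_num) hA) v
    have huX : u ∉ (A ∩ B) ∪ {v} ∪ (fun x => (p x).2) '' R := by
      rintro ((h | h) | ⟨x, hx, rfl⟩)
      · exact hu.2 h.2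
      · exact huv h
      · exact hu.2 (hp x hx.1.1).2.2.1
    have hwX : w ∉ (A ∩ B) ∪ {v} ∪ (fun x => (p x).2) '' R := by
      rintro ((h | rfl) | h)
      · exact hw.2 h.1
      · exact hv.2 hw.1
      · exact hwR h
    obtain ⟨c, ⟨hc, hcX⟩, d, ⟨hd, hdX⟩, hcd⟩ := hG.exists_adj_of_encard_lt_s10 (U := A \ B) hXcard
      ⟨u, hu, huX⟩ ⟨w, fun h => h.2 hw.1, hwX⟩
    have hd' : d ∈ B \ A := (hcover d hd).resolve_left fun h => hdX (.inl (.inl h))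
    refine hdX (.inr ⟨s(c, d), hmemR hc hd' hcd fun h => hcX (.inl (.inr h)), ?_⟩)
    simp [hp_mk hc hd' hcd]
  · push Not at hB
    obtain ⟨g, hgR, hgb⟩ := hB b hb
    obtain ⟨q, hq, hqr⟩ : ∃ q : ℕ, (R \ {g}).encard = q ∧ q + 1 = r := by
      have h := encard_sdiff_singleton_add_one hgR
      rw [hr] at h
      generalize (R \ {g}).encard = n at *
      induction n using ENat.recTopCoe with
      | top => simp at h
      | coe n => exact ⟨n, rfl, by exact_mod_cast h⟩
    have hXcard : ((A ∩ B) ∪ {v} ∪ {b} ∪ (fun x => (p x).1) '' (R \ {g})).encard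
        < ((4 : ℕ) : ℕ∞) := by
      have h₁ := encard_union_le ((A ∩ B) ∪ {v} ∪ {b}) ((fun x => (p x).1) '' (R \ {g}))
      have h₂ := encard_union_le ((A ∩ B) ∪ {v}) {b}
      have h₃ := encard_union_le (A ∩ B) {v}
      have h₄ := encard_image_le (fun x => (p x).1) (R \ {g})
      rw [encard_singleton] at h₂ h₃
      rw [hk] at h₃
      rw [hq] at h₄
      refine (h₁.trans (add_le_add (h₂.trans (add_le_add_left h₃ 1)) h₄)).trans_lt ?_
      norm_cast
      omega
    have hAX : ((A \ B) \ ((A ∩ B) ∪ {v} ∪ {b} ∪ (fun x => (p x).1) '' (R \ {g}))).Nonempty := by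
      by_contra hne
      rw [not_nonempty_iff_eq_empty, sdiff_eq_empty] at hne
      have hsub : (univ : Set V) ⊆
          (A ∩ B) ∪ {v} ∪ (fun x => (p x).1) '' (R \ {g}) ∪ (fun x => (p x).2) '' R := by
        intro x _
        by_cases hx : x ∈ A \ B
        · rcases hne hx with ((h | h) | rfl) | h
          · exact .inl (.inl (.inl h))
          · exact .inl (.inl (.inr h))
          · exact absurd hb.1 hx.2
          · exact .inl (.inr h)
        · rcases hcover x hx with h | h
          · exact .inl (.inl (.inl h))
          · exact .inr (hB x h)
      have h₀ := encard_le_encard hsub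
      have h₁ := encard_union_le ((A ∩ B) ∪ {v} ∪ (fun x => (p x).1) '' (R \ {g}))
        ((fun x => (p x).2) '' R)
      have h₂ := encard_union_le ((A ∩ B) ∪ {v}) ((fun x => (p x).1) '' (R \ {g}))
      have h₃ := encard_union_le (A ∩ B) {v}
      have h₄ := encard_image_le (fun x => (p x).1) (R \ {g})
      have h₅ := encard_image_le (fun x => (p x).2) R
      have h₆ : (4 : ℕ∞) < (univ : Set V).encard := hG.1
      rw [encard_singleton] at h₃
      rw [hk] at h₃
      rw [hq] at h₄
      rw [hr] at h₅
      have h₇ := h₆.trans_le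
        (h₀.trans (h₁.trans (add_le_add (h₂.trans (add_le_add h₃ h₄)) h₅)))
      norm_cast at h₇
      omega
    have haX : a ∉ (A ∩ B) ∪ {v} ∪ {b} ∪ (fun x => (p x).1) '' (R \ {g}) := by
      rintro (((h | rfl) | h) | ⟨x, hx, rfl⟩)
      · exact ha.2 h.1
      · exact hv.2 ha.1
      · exact hab h
      · exact ha.2 (hp x hx.1.1.1).2.1.1
    obtain ⟨c, ⟨hc, hcX⟩, d, ⟨hd, hdX⟩, hcd⟩ := hG.exists_adj_of_encard_lt_s10 (U := A \ B) hXcard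
      hAX ⟨a, fun h => h.2 ha.1, haX⟩
    have hd' : d ∈ B \ A := (hcover d hd).resolve_left fun h => hdX (.inl (.inl (.inl h)))
    have hpcd := hp_mk hc hd' hcd
    refine hcX (.inr ⟨s(c, d), ⟨hmemR hc hd' hcd fun h => hcX (.inl (.inl (.inr h))), ?_⟩, ?_⟩)
    · rintro rfl
      exact hdX (.inl (.inr (by simpa [hpcd] using hgb)))
    · simp [hpcd]

/-- equivalences for mixed-4-separations⁺ whose separator vertices
have at least two neighbours in `A \ B`. -/
theorem left_degree_stronger_matching (G : SimpleGraph V) (A B : Set V)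
    (hG : KConnected G 4) (hplus : IsMixedSepPlus A B) (hord : sepOrder G A B = 4)
    (hdeg : ∀ v ∈ A ∩ B, 2 ≤ (G.neighborSet v ∩ (A \ B)).encard) :
    ((∀ e ∈ sepEdges G A B, ∀ f ∈ sepEdges G A B, e ≠ f →
        ∀ v ∈ A \ B, ¬ (v ∈ e ∧ v ∈ f)) ↔
      ¬ (A ∩ B = ∅ ∧ A.encard = 1)) ∧
    (¬ (A ∩ B = ∅ ∧ A.encard = 1) ↔ 2 ≤ (A \ B).encard) := by
  have h₂₃ : ¬ (A ∩ B = ∅ ∧ A.encard = 1) ↔ 2 ≤ (A \ B).encard := by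
    refine ⟨fun h => ?_, fun h ⟨_, h₁⟩ => ?_⟩
    · by_contra hlt
      have hAB : A ∩ B = ∅ := by
        by_contra hne
        obtain ⟨v, hv⟩ := nonempty_iff_ne_empty.2 hne
        exact hlt ((hdeg v hv).trans (encard_le_encard inter_subset_right))
      have hdiff : A \ B = A := sdiff_eq_left.2 (disjoint_iff_inter_eq_empty.2 hAB)
      rw [hdiff] at hlt
      have hA0 : A.encard ≠ 0 := by
        intro h0
        rw [encard_eq_zero] at h0
        simp [sepOrder, sepEdges, h0] at hord
      have hA1 : A.encard ≠ 1 := fun h1 => h ⟨hAB, h1⟩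
      rw [not_le, ← one_add_one_eq_two, ENat.lt_add_one_iff ENat.one_ne_top] at hlt
      exact hA1 (hlt.antisymm (Order.one_le_iff_ne_zero.2 hA0))
    · have := (h.trans (encard_le_encard sdiff_subset)).trans_eq h₁
      norm_num at this
  refine ⟨⟨fun h ⟨hAB, hA⟩ => ?_, fun h e he f hf hef v hv =>
    sepEdges_not_share_left hG hplus hord (h₂₃.1 h) he hf hef hv⟩, h₂₃⟩
  obtain ⟨a, rfl⟩ := encard_eq_one.1 hA
  have hcard : 1 < (sepEdges G {a} B).encard := by
    simp only [sepOrder, hAB, encard_empty, zero_add] at hord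
    rw [hord]
    norm_num
  obtain ⟨e, f, he, hf, hef⟩ := one_lt_encard_iff.1 hcard
  obtain ⟨-, x, y, hxy, hx, -⟩ := id he
  obtain ⟨-, x', y', hxy', hx', -⟩ := id hf
  obtain rfl : x = a := hx.1
  obtain rfl : x' = x := hx'.1
  exact h e he f hf hef x' hx ⟨by simp [hxy], by simp [hxy']⟩
end Paper
end

section
/- Let (A,B) be a tetra-separation of a 4-connected graph G. Then the following assertions are equivalent: (1) (A,B) is half-connected; (2) no tetra-separation of G crosses (A,B) so that all four links are empty. -/
open Set

namespace Paper

variable {V : Type*}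

/-- In a connected induced subgraph, some edge leaves every proper nonempty part. -/
lemma exists_adj_of_induce_connected {G : SimpleGraph V} {S P : Set V}
    (h : (G.induce S).Connected) {p q : V} (hpP : p ∈ P) (hpS : p ∈ S) (hqP : q ∉ P)
    (hqS : q ∈ S) : ∃ u ∈ P, ∃ v ∈ S \ P, G.Adj u v := by
  obtain ⟨w⟩ := h.preconnected ⟨p, hpS⟩ ⟨q, hqS⟩
  obtain ⟨d, -, hd, hd'⟩ := w.exists_boundary_dart {x | (x : V) ∈ P} hpP hqP
  exact ⟨d.fst, hd, d.snd, ⟨d.snd.2, hd'⟩, d.adj⟩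

/-- A nonempty vertex set inducing a disconnected subgraph splits into two nonempty parts
with no edges between them. -/
lemma exists_split_of_not_connected {G : SimpleGraph V} {S : Set V} (hS : S.Nonempty)
    (h : ¬ (G.induce S).Connected) :
    ∃ P Q : Set V, P.Nonempty ∧ Q.Nonempty ∧ P ∪ Q = S ∧ Disjoint P Q ∧
      ∀ p ∈ P, ∀ q ∈ Q, ¬ G.Adj p q := by
  have : Nonempty S := hS.to_subtype
  have h' : ¬ (G.induce S).Preconnected := fun hp => h ⟨hp⟩
  simp only [SimpleGraph.Preconnected, not_forall] at h'
  obtain ⟨u, v, huv⟩ := h'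
  refine ⟨(↑) '' {w : S | (G.induce S).Reachable u w},
    (↑) '' {w : S | ¬ (G.induce S).Reachable u w}, ⟨u, u, .refl u, rfl⟩, ⟨v, v, huv, rfl⟩,
    ?_, ?_, ?_⟩
  · rw [← image_union]
    have : {w : S | (G.induce S).Reachable u w} ∪ {w : S | ¬ (G.induce S).Reachable u w} = univ :=
      union_compl_self _
    rw [this, image_univ, Subtype.range_coe]
  · rw [disjoint_image_iff Subtype.val_injective]
    exact disjoint_left.2 fun w hw hw' => hw' hw
  · rintro _ ⟨p, hp, rfl⟩ _ ⟨q, hq, rfl⟩ hpq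
    exact hq (hp.trans (SimpleGraph.Adj.reachable hpq))

lemma KConnected.exists_adj {G : SimpleGraph V} {k : ℕ} (hG : KConnected G k) {P Y : Set V}
    (hY : Y.encard < k) {p q : V} (hp : p ∈ P) (hpY : p ∉ Y) (hq : q ∉ P) (hqY : q ∉ Y) :
    ∃ u ∈ P, ∃ v, v ∉ P ∧ v ∉ Y ∧ G.Adj u v := by
  obtain ⟨u, hu, v, hv, huv⟩ := exists_adj_of_induce_connected (hG.2 Y hY) hp hpY hq hqY
  exact ⟨u, hu, v, hv.2, hv.1, huv⟩

/-- In a `k`-connected graph, every vertex of a `k`-separator sends an edge to every part that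
the separator cuts off. -/
lemma KConnected.exists_adj_of_mem_separator {G : SimpleGraph V} {k : ℕ} (hG : KConnected G k)
    {P X : Set V} (hX : X.encard = k) {p q x : V} (hp : p ∈ P) (hPX : Disjoint P X)
    (hq : q ∉ P) (hqX : q ∉ X) (hN : ∀ u ∈ P, ∀ v, v ∉ P → G.Adj u v → v ∈ X) (hx : x ∈ X) :
    ∃ u ∈ P, G.Adj x u := by
  have hlt : (X \ {x}).encard < k := by
    rw [← hX]
    exact (finite_of_encard_eq_coe hX).sdiff.encard_lt_encard
      (sdiff_singleton_ssubset.2 hx)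
  obtain ⟨u, hu, v, hvP, hv, huv⟩ := hG.exists_adj hlt hp
    (fun h => disjoint_left.1 hPX hp h.1) hq (fun h => hqX h.1)
  have hvx : v = x := by
    by_contra hne
    exact hv ⟨hN u hu v hvP huv, hne⟩
  exact ⟨u, hu, hvx ▸ huv.symm⟩

/-- If the side `A \ B` of a mixed-separation of order `k` of a `k`-connected graph splits into
`P` and `Q`, then no edge of the separator has an endvertex in `Q`. -/
lemma KConnected.not_adj_of_split {G : SimpleGraph V} {k : ℕ} (hG : KConnected G k)
    {A B P Q : Set V} (hAB : A ∪ B = univ) (hord : sepOrder G A B = k) (hP : P.Nonempty)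
    (hPQ : P ∪ Q = A \ B) (hdisj : Disjoint P Q) (hadj : ∀ p ∈ P, ∀ q ∈ Q, ¬ G.Adj p q)
    {a b : V} (ha : a ∈ Q) (hb : b ∈ B \ A) : ¬ G.Adj a b := by
  intro hab
  have haA : a ∈ A \ B := hPQ ▸ Or.inr ha
  have he : s(a, b) ∈ sepEdges G A B := ⟨hab, a, b, rfl, haA, hb⟩
  set T : Set V := {v | v ∈ B \ A ∧ ∃ u ∈ P, G.Adj u v}
  have hT : T.encard ≤ (sepEdges G A B \ {s(a, b)}).encard := by
    have hex : ∀ v, ∃ u, v ∈ T → u ∈ P ∧ G.Adj u v := by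
      intro v
      by_cases hv : v ∈ T
      · obtain ⟨u, hu⟩ := hv.2
        exact ⟨u, fun _ => hu⟩
      · exact ⟨v, fun h => absurd h hv⟩
    choose f hf using hex
    refine encard_le_encard_of_injOn (f := fun v => s(f v, v)) ?_ ?_
    · intro v hv
      have hfA : f v ∈ A \ B := hPQ ▸ Or.inl (hf v hv).1
      refine ⟨⟨(hf v hv).2, f v, v, rfl, hfA, hv.1⟩, fun h => ?_⟩
      rcases Sym2.eq_iff.1 (mem_singleton_iff.1 h) with ⟨h, -⟩ | ⟨h, -⟩
      · exact disjoint_left.1 hdisj (hf v hv).1 (h ▸ ha)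
      · exact hfA.2 (h ▸ hb.1)
    · intro v hv w hw h
      have hfA : f v ∈ A \ B := hPQ ▸ Or.inl (hf v hv).1
      rcases Sym2.eq_iff.1 h with ⟨-, h⟩ | ⟨h, -⟩
      · exact h
      · exact absurd hw.1.1 (h ▸ hfA.2)
  have hlt : (A ∩ B ∪ T).encard < k := by
    have hfin : (A ∩ B).encard + (sepEdges G A B).encard ≠ ⊤ := by
      rw [← sepOrder, hord]
      exact ENat.natCast_ne_top k
    obtain ⟨hX, hF⟩ := WithTop.add_ne_top.1 hfin
    have hFlt : (sepEdges G A B \ {s(a, b)}).encard < (sepEdges G A B).encard :=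
      (encard_ne_top_iff.1 hF).sdiff.encard_lt_encard (sdiff_singleton_ssubset.2 he)
    calc (A ∩ B ∪ T).encard ≤ (A ∩ B).encard + T.encard := encard_union_le _ _
      _ < (A ∩ B).encard + (sepEdges G A B).encard :=
        (ENat.add_lt_add_iff_left hX).2 (hT.trans_lt hFlt)
      _ = k := hord
  obtain ⟨p, hp⟩ := hP
  have hpA : p ∈ A \ B := hPQ ▸ Or.inl hp
  obtain ⟨u, hu, v, hvP, hv, huv⟩ := hG.exists_adj hlt hp
    (fun h => h.elim (fun h => hpA.2 h.2) (fun h => h.1.2 hpA.1))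
    (disjoint_right.1 hdisj ha)
    (fun h => h.elim (fun h => haA.2 h.2) (fun h => h.1.2 haA.1))
  have hvX : v ∉ A ∩ B := fun h => hv (.inl h)
  by_cases hvB : v ∈ B
  · exact hv (.inr ⟨⟨hvB, fun h => hvX ⟨h, hvB⟩⟩, u, hu, huv⟩)
  · have hvA : v ∈ A := (hAB ▸ mem_univ v : v ∈ A ∪ B).resolve_right hvB
    have : v ∈ P ∪ Q := hPQ ▸ ⟨hvA, hvB⟩
    exact hadj u hu v (this.resolve_left hvP) huv

lemma sepEdges_eq_empty_iff {G : SimpleGraph V} {A B : Set V} :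
    sepEdges G A B = ∅ ↔ ∀ a ∈ A \ B, ∀ b ∈ B \ A, ¬ G.Adj a b := by
  refine ⟨fun h a ha b hb hab => ?_, fun h => eq_empty_of_forall_notMem ?_⟩
  · exact (h ▸ (⟨hab, a, b, rfl, ha, hb⟩ : s(a, b) ∈ sepEdges G A B) : s(a, b) ∈ (∅ : Set _))
  · rintro _ ⟨he, a, b, rfl, ha, hb⟩
    exact h a ha b hb he

/-- If all four links are empty, the separators have the same vertices. -/
lemma inter_eq_of_links_empty {G : SimpleGraph V} {A B C D : Set V} (hAB : A ∪ B = univ)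
    (hCD : C ∪ D = univ) (h₁ : link G C D A B = ∅) (h₂ : link G C D B A = ∅)
    (h₃ : link G A B C D = ∅) (h₄ : link G A B D C = ∅) : A ∩ B = C ∩ D := by
  simp only [link, union_empty_iff, image_eq_empty] at h₁ h₂ h₃ h₄
  have mAB : ∀ x, x ∈ A ∨ x ∈ B := fun x => (hAB ▸ mem_univ x : x ∈ A ∪ B)
  have mCD : ∀ x, x ∈ C ∨ x ∈ D := fun x => (hCD ▸ mem_univ x : x ∈ C ∪ D)
  have e₁ := fun x => eq_empty_iff_forall_notMem.1 h₁.1 x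
  have e₂ := fun x => eq_empty_iff_forall_notMem.1 h₂.1 x
  have e₃ := fun x => eq_empty_iff_forall_notMem.1 h₃.1 x
  have e₄ := fun x => eq_empty_iff_forall_notMem.1 h₄.1 x
  clear h₁ h₂ h₃ h₄
  ext x
  specialize mAB x
  specialize mCD x
  specialize e₁ x
  specialize e₂ x
  specialize e₃ x
  specialize e₄ x
  simp only [mem_inter_iff, mem_sdiff] at *
  tauto

/-- If the `A`-link is empty, there are no edges between the corners for `AC` and `AD`. -/
lemma not_adj_of_link_empty {G : SimpleGraph V} {A B C D : Set V} (h : link G C D A B = ∅)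
    {a b : V} (ha : a ∈ corner A B C D) (hb : b ∈ corner A B D C) : ¬ G.Adj a b := by
  intro hab
  simp only [link, union_empty_iff, image_eq_empty] at h
  refine eq_empty_iff_forall_notMem.1 h.2 s(a, b)
    ⟨⟨hab, a, b, rfl, ha.2, hb.2⟩, ?_, a, by simp, .inl ⟨ha.2, ha.1⟩⟩
  rintro ⟨-, c, d, hcd, ⟨hc, hd⟩ | ⟨hc, hd⟩⟩ <;>
    rcases Sym2.eq_iff.1 hcd with ⟨rfl, rfl⟩ | ⟨rfl, rfl⟩ <;>
    simp only [corner, mem_inter_iff, mem_sdiff] at * <;> tauto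

/-- A separation with connected left side is nested with every separation that has the same
separator vertices and an empty `A`-link. -/
lemma nested_of_connected {G : SimpleGraph V} {A B C D : Set V} (hAB : A ∪ B = univ)
    (hCD : C ∪ D = univ) (hconn : (G.induce (A \ B)).Connected) (hX : A ∩ B = C ∩ D)
    (h : link G C D A B = ∅) : Nested A B C D := by
  have key : corner A B C D = ∅ ∨ corner A B D C = ∅ := by
    by_contra hne
    simp only [not_or, ← nonempty_iff_ne_empty] at hne
    obtain ⟨⟨p, hp⟩, q, hq⟩ := hne
    obtain ⟨u, hu, v, hv, huv⟩ := exists_adj_of_induce_connected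
      (P := corner A B C D) hconn hp hp.1 (fun h => hq.2.2 h.2.1) hq.1
    refine not_adj_of_link_empty h hu ⟨hv.1, ?_⟩ huv
    have h₁ := Set.ext_iff.1 hCD v
    have h₂ := Set.ext_iff.1 hX v
    simp only [corner, mem_inter_iff, mem_union, mem_sdiff, mem_univ] at *
    tauto
  rcases key with key | key
  · refine .inr (.inl ⟨fun x hx => ?_, fun x hx => ?_⟩) <;>
    · have h₁ := Set.ext_iff.1 hCD x
      have h₂ := Set.ext_iff.1 hX x
      have h₃ := Set.ext_iff.1 key x
      have h₄ := Set.ext_iff.1 hAB x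
      simp only [corner, mem_inter_iff, mem_union, mem_sdiff, mem_univ, mem_empty_iff_false] at *
      tauto
  · refine .inl ⟨fun x hx => ?_, fun x hx => ?_⟩ <;>
    · have h₁ := Set.ext_iff.1 hCD x
      have h₂ := Set.ext_iff.1 hX x
      have h₃ := Set.ext_iff.1 key x
      have h₄ := Set.ext_iff.1 hAB x
      simp only [corner, mem_inter_iff, mem_union, mem_sdiff, mem_univ, mem_empty_iff_false] at *
      tauto

lemma nested_swap {A B C D : Set V} (h : Nested B A C D) : Nested A B C D := by
  unfold Nested at *
  tauto

lemma link_eq_empty {G : SimpleGraph V} {A B C D : Set V} (hX : A ∩ B ⊆ C ∩ D)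
    (hE : sepEdges G A B = ∅) : link G A B C D = ∅ ∧ link G A B D C = ∅ := by
  constructor <;>
  · simp only [link, hE, union_empty_iff, image_eq_empty]
    refine ⟨eq_empty_of_forall_notMem fun x hx => ?_, by simp⟩
    exact hx.1.2 (by first | exact (hX hx.2).2 | exact (hX hx.2).1)

lemma two_le_encard_of_mem {S : Set V} {a b : V} (ha : a ∈ S) (hb : b ∈ S) (hab : a ≠ b) :
    2 ≤ S.encard := by
  rw [← encard_pair hab]
  exact encard_le_encard (pair_subset ha hb)

/-- If neither side is connected, some tetra-separation crosses with all links empty. -/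
lemma exists_crossing_of_not_halfConnected {G : SimpleGraph V} {A B : Set V}
    (hG : KConnected G 4) (hAB : IsTetraSep G A B) (hA : ¬ (G.induce (A \ B)).Connected)
    (hB : ¬ (G.induce (B \ A)).Connected) :
    ∃ C D : Set V, IsTetraSep G C D ∧ Crosses A B C D ∧
      link G C D A B = ∅ ∧ link G C D B A = ∅ ∧
      link G A B C D = ∅ ∧ link G A B D C = ∅ := by
  obtain ⟨⟨hun, hAne, hBne⟩, hord, -, -⟩ := hAB
  obtain ⟨P, Q, hP, hQ, hPQ, hPQd, hPQa⟩ := exists_split_of_not_connected hAne hA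
  obtain ⟨R, S, hR, hS, hRS, hRSd, hRSa⟩ := exists_split_of_not_connected hBne hB
  have hF : ∀ a ∈ A \ B, ∀ b ∈ B \ A, ¬ G.Adj a b := by
    intro a ha b hb
    rcases (hPQ ▸ ha : a ∈ P ∪ Q) with ha | ha
    · exact hG.not_adj_of_split hun hord hQ (union_comm P Q ▸ hPQ) hPQd.symm
        (fun q hq p hp h => hPQa p hp q hq h.symm) ha hb
    · exact hG.not_adj_of_split hun hord hP hPQ hPQd hPQa ha hb
  have hE : sepEdges G A B = ∅ := sepEdges_eq_empty_iff.2 hF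
  have hX : (A ∩ B).encard = (4 : ℕ) := by simpa [sepOrder, hE] using hord
  have mAB : ∀ x, x ∈ A ∨ x ∈ B := fun x => (hun ▸ mem_univ x : x ∈ A ∪ B)
  have mPQ : ∀ x, (x ∈ P ∨ x ∈ Q) ↔ x ∈ A ∧ x ∉ B := fun x => Set.ext_iff.1 hPQ x
  have mRS : ∀ x, (x ∈ R ∨ x ∈ S) ↔ x ∈ B ∧ x ∉ A := fun x => Set.ext_iff.1 hRS x
  have dPQ : ∀ x, x ∈ P → x ∉ Q := fun _ h => disjoint_left.1 hPQd h
  have dRS : ∀ x, x ∈ R → x ∉ S := fun _ h => disjoint_left.1 hRSd h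
  obtain ⟨p, hp⟩ := hP
  obtain ⟨q, hq⟩ := hQ
  obtain ⟨r, hr⟩ := hR
  obtain ⟨s, hs⟩ := hS
  have nP : ∀ x ∈ A ∩ B, ∃ u ∈ P, G.Adj x u := fun x hx =>
    hG.exists_adj_of_mem_separator hX hp (disjoint_left.2 fun y => by grind) (q := q) (by grind)
      (by grind) (fun u hu v hv huv => by grind) hx
  have nQ : ∀ x ∈ A ∩ B, ∃ u ∈ Q, G.Adj x u := fun x hx =>
    hG.exists_adj_of_mem_separator hX hq (disjoint_left.2 fun y => by grind) (q := p) (by grind)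
      (by grind) (fun u hu v hv huv => by grind [huv.symm]) hx
  have nR : ∀ x ∈ A ∩ B, ∃ u ∈ R, G.Adj x u := fun x hx =>
    hG.exists_adj_of_mem_separator hX hr (disjoint_left.2 fun y => by grind) (q := s) (by grind)
      (by grind) (fun u hu v hv huv => by grind [huv.symm]) hx
  have nS : ∀ x ∈ A ∩ B, ∃ u ∈ S, G.Adj x u := fun x hx =>
    hG.exists_adj_of_mem_separator hX hs (disjoint_left.2 fun y => by grind) (q := r) (by grind)
      (by grind) (fun u hu v hv huv => by grind [huv.symm]) hx
  set C : Set V := A ∩ B ∪ (P ∪ R)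
  set D : Set V := A ∩ B ∪ (Q ∪ S)
  have hCD : C ∩ D = A ∩ B := by grind
  have hCsD : C \ D = P ∪ R := by grind
  have hDsC : D \ C = Q ∪ S := by grind
  have hE' : sepEdges G C D = ∅ := by
    rw [sepEdges_eq_empty_iff, hCsD, hDsC]
    intro a ha b hb hab
    grind [hab.symm]
  refine ⟨C, D, ⟨⟨by ext x; grind, ⟨p, by grind⟩, ⟨q, by grind⟩⟩, ?_, ?_, ?_⟩, ?_,
    (link_eq_empty hCD.le hE').1, (link_eq_empty hCD.le hE').2,
    (link_eq_empty hCD.ge hE).1, (link_eq_empty hCD.ge hE).2⟩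
  · simpa [sepOrder, hCD, hE'] using hX
  · intro x hx
    rw [hCD] at hx
    rw [hCsD, hDsC]
    obtain ⟨u₁, h₁, k₁⟩ := nP x hx
    obtain ⟨u₂, h₂, k₂⟩ := nQ x hx
    obtain ⟨u₃, h₃, k₃⟩ := nR x hx
    obtain ⟨u₄, h₄, k₄⟩ := nS x hx
    exact ⟨two_le_encard_of_mem ⟨k₁, .inl h₁⟩ ⟨k₃, .inr h₃⟩ (by grind),
      two_le_encard_of_mem ⟨k₂, .inl h₂⟩ ⟨k₄, .inr h₄⟩ (by grind)⟩
  · simp [MatchingCondition, hE']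
  · rintro (h | h | h | h)
    · have := h.1 ((mPQ q).1 (.inr hq)).1
      grind
    · have := h.1 ((mPQ p).1 (.inl hp)).1
      grind
    · have := h.1 ((mRS s).1 (.inr hs)).1
      grind
    · have := h.1 ((mRS r).1 (.inl hr)).1
      grind

/-- half-connectedness of a tetra-separation. -/
theorem nestedness_half_connected (G : SimpleGraph V) (A B : Set V)
    (hG : KConnected G 4) (hAB : IsTetraSep G A B) :
    HalfConnected G A B ↔
      ¬ ∃ C D : Set V, IsTetraSep G C D ∧ Crosses A B C D ∧
        link G C D A B = ∅ ∧ link G C D B A = ∅ ∧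
        link G A B C D = ∅ ∧ link G A B D C = ∅ := by
  constructor
  · rintro h ⟨C, D, hCD, hcross, h₁, h₂, h₃, h₄⟩
    have hun := hAB.1.1
    have hX := inter_eq_of_links_empty hun hCD.1.1 h₁ h₂ h₃ h₄
    rcases h with h | h
    · exact hcross (nested_of_connected hun hCD.1.1 h hX h₁)
    · exact hcross (nested_swap
        (nested_of_connected (union_comm A B ▸ hun) hCD.1.1 h (inter_comm A B ▸ hX) h₂))
  · intro h
    by_contra hh
    rw [HalfConnected, not_or] at hh
    exact h (exists_crossing_of_not_halfConnected hG hAB hh.1 hh.2)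
end Paper
end

section
/- Let G be a 4-connected graph and let (A,B) be a mixed-4-separation of G that is not half-connected. Then (A,B) is a tetra-separation. -/
open Set

namespace Paper

variable {V : Type*}

/-- A nonempty vertex set all of whose neighbours outside it lie in a set `X` of fewer than `k`
vertices contains every vertex outside `X`. -/
theorem KConnected.mem_of_neighbors_subset {G : SimpleGraph V} {k : ℕ} (hG : KConnected G k)
    {X C : Set V} (hX : X.encard < k) (hC : C.Nonempty) (hCX : Disjoint C X)
    (hN : ∀ c ∈ C, ∀ w, G.Adj c w → w ∈ C ∪ X) {v : V} (hv : v ∉ X) : v ∈ C := by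
  obtain ⟨c, hc⟩ := hC
  have hcX : c ∉ X := Set.disjoint_left.mp hCX hc
  obtain ⟨p⟩ := (hG.2 X hX).preconnected ⟨c, hcX⟩ ⟨v, hv⟩
  have walk_mem : ∀ {a b : (Xᶜ : Set V)}, (G.induce (Xᶜ : Set V)).Walk a b →
      a.1 ∈ C → b.1 ∈ C := by
    intro a b p
    induction p with
    | nil => exact id
    | @cons a b _ hab _ ih => exact fun ha => ih ((hN _ ha _ hab).resolve_right b.2)
  exact walk_mem p hc

/-- A nonempty vertex set inducing a disconnected subgraph splits into two nonempty parts
with no edges between them. -/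
theorem exists_split_of_not_connected_s17 {G : SimpleGraph V} {U : Set V} (hU : U.Nonempty)
    (h : ¬ (G.induce U).Connected) :
    ∃ C D : Set V, C.Nonempty ∧ D.Nonempty ∧ C ∪ D = U ∧ Disjoint C D ∧
      ∀ c ∈ C, ∀ d ∈ D, ¬ G.Adj c d := by
  have : Nonempty U := hU.to_subtype
  have hpre : ¬ (G.induce U).Preconnected := fun hp => h ⟨hp⟩
  simp only [SimpleGraph.Preconnected, not_forall] at hpre
  obtain ⟨u, v, huv⟩ := hpre
  refine ⟨Subtype.val '' {w | (G.induce U).Reachable u w},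
    Subtype.val '' {w | ¬ (G.induce U).Reachable u w},
    ⟨_, u, SimpleGraph.Reachable.refl u, rfl⟩, ⟨_, v, huv, rfl⟩, ?_, ?_, ?_⟩
  · rw [← Set.image_union]
    ext x
    simp [← exists_or, em]
  · rw [Set.disjoint_left]
    rintro _ ⟨a, ha, rfl⟩ ⟨b, hb, hab⟩
    exact hb (Subtype.ext hab ▸ ha)
  · rintro _ ⟨a, ha, rfl⟩ _ ⟨b, hb, rfl⟩ hab
    have hab' : (G.induce U).Adj a b := hab
    exact hb (SimpleGraph.Reachable.trans ha hab'.reachable)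

theorem sepEdges_comm (G : SimpleGraph V) (A B : Set V) : sepEdges G A B = sepEdges G B A := by
  ext e
  constructor <;> rintro ⟨he, a, b, rfl, ha, hb⟩ <;> exact ⟨he, b, a, Sym2.eq_swap, hb, ha⟩

theorem sepOrder_comm (G : SimpleGraph V) (A B : Set V) : sepOrder G A B = sepOrder G B A := by
  rw [sepOrder, sepOrder, sepEdges_comm, Set.inter_comm]

/-- If one proper side of a mixed-separation of order `k` splits into two parts without edges
between them, then no edge of the separator ends in the second part. -/
theorem KConnected.not_adj_of_split_s17 {G : SimpleGraph V} {k : ℕ} (hG : KConnected G k)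
    {A B C D : Set V} (hcov : A ∪ B = Set.univ) (hord : sepOrder G A B = k)
    (hC : C.Nonempty) (hCD : C ∪ D = A \ B) (hdisj : Disjoint C D)
    (hadj : ∀ c ∈ C, ∀ d ∈ D, ¬ G.Adj c d) {d b : V} (hd : d ∈ D) (hb : b ∈ B \ A) :
    ¬ G.Adj d b := by
  intro hdb
  have hCA : C ⊆ A \ B := hCD ▸ Set.subset_union_left
  have hDA : D ⊆ A \ B := hCD ▸ Set.subset_union_right
  set N : Set V := {w | w ∈ B \ A ∧ ∃ c ∈ C, G.Adj c w} with hNdef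
  have he : s(d, b) ∈ sepEdges G A B := ⟨hdb, d, b, rfl, hDA hd, hb⟩
  have hle : N.encard ≤ (sepEdges G A B \ {s(d, b)}).encard := by
    choose! f hfC hfadj using fun w (hw : w ∈ N) => hw.2
    refine Set.encard_le_encard_of_injOn (f := fun w => s(f w, w)) ?_ ?_
    · intro w hw
      refine ⟨⟨hfadj w hw, f w, w, rfl, hCA (hfC w hw), hw.1⟩, fun heq => ?_⟩
      rcases Sym2.eq_iff.mp (Set.mem_singleton_iff.mp heq) with ⟨h, -⟩ | ⟨h, -⟩
      · exact Set.disjoint_left.mp hdisj (hfC w hw) (h ▸ hd)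
      · exact hb.2 (h ▸ (hCA (hfC w hw)).1)
    · intro w hw w' hw' heq
      rcases Sym2.eq_iff.mp heq with ⟨-, h⟩ | ⟨h, -⟩
      · exact h
      · exact absurd (hCA (hfC w hw)).1 (h ▸ hw'.1.2)
  have hlt : (A ∩ B ∪ N).encard < k := by
    have h1 : (A ∩ B).encard + (sepEdges G A B \ {s(d, b)}).encard + 1 = k := by
      rw [add_assoc, Set.encard_sdiff_singleton_add_one he]
      exact hord
    have h2 : (A ∩ B ∪ N).encard + 1 ≤ k := by
      rw [← h1]
      gcongr
      exact (Set.encard_union_le _ _).trans (by gcongr)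
    exact (ENat.add_one_le_iff (fun h => by simp [h] at h2)).mp h2
  refine Set.disjoint_left.mp hdisj (hG.mem_of_neighbors_subset hlt hC ?_ ?_ (v := d) ?_) hd
  · rw [Set.disjoint_left]
    rintro c hc (h | h)
    · exact (hCA hc).2 h.2
    · exact h.1.2 (hCA hc).1
  · intro c hc w hcw
    have hw : w ∈ A ∪ B := hcov ▸ Set.mem_univ w
    by_cases hwA : w ∈ A
    · by_cases hwB : w ∈ B
      · exact .inr (.inl ⟨hwA, hwB⟩)
      · have : w ∈ C ∪ D := hCD ▸ ⟨hwA, hwB⟩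
        exact this.imp id fun h => absurd hcw (hadj c hc w h)
    · exact .inr (.inr ⟨⟨hw.resolve_left hwA, hwA⟩, c, hc, hcw⟩)
  · rintro (h | h)
    · exact (hDA hd).2 h.2
    · exact h.1.2 (hDA hd).1

theorem KConnected.sepEdges_eq_empty {G : SimpleGraph V} {k : ℕ} (hG : KConnected G k)
    {A B : Set V} (hAB : IsMixedSep A B) (hord : sepOrder G A B = k)
    (hA : ¬ (G.induce (A \ B)).Connected) : sepEdges G A B = ∅ := by
  obtain ⟨C, D, hC, hD, hCD, hdisj, hadj⟩ := exists_split_of_not_connected_s17 hAB.2.1 hA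
  rw [Set.eq_empty_iff_forall_notMem]
  rintro _ ⟨he, a, b, rfl, ha, hb⟩
  rcases (hCD ▸ ha : a ∈ C ∪ D) with h | h
  · exact hG.not_adj_of_split_s17 hAB.1 hord hD (Set.union_comm C D ▸ hCD) hdisj.symm
      (fun d hd c hc hdc => hadj c hc d hd hdc.symm) h hb he
  · exact hG.not_adj_of_split_s17 hAB.1 hord hC hCD hdisj hadj h hb he

/-- If one proper side of a mixed-separation of order `k` without edges in its separator splits
into two parts without edges between them, then every vertex of the separator has a neighbour
in the first part. -/
theorem KConnected.exists_adj_of_split {G : SimpleGraph V} {k : ℕ} (hG : KConnected G k)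
    {A B C D : Set V} (hcov : A ∪ B = Set.univ) (hord : sepOrder G A B = k)
    (hedges : sepEdges G A B = ∅) (hC : C.Nonempty) (hD : D.Nonempty) (hCD : C ∪ D = A \ B)
    (hdisj : Disjoint C D) (hadj : ∀ c ∈ C, ∀ d ∈ D, ¬ G.Adj c d) {v : V} (hv : v ∈ A ∩ B) :
    ∃ c ∈ C, G.Adj v c := by
  by_contra! hno
  have hCA : C ⊆ A \ B := hCD ▸ Set.subset_union_left
  have hlt : ((A ∩ B) \ {v}).encard < k := by
    have h1 : ((A ∩ B) \ {v}).encard + 1 = k := by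
      rw [Set.encard_sdiff_singleton_add_one hv]
      simpa [sepOrder, hedges] using hord
    exact (ENat.add_one_le_iff (fun h => by simp [h] at h1)).mp h1.le
  obtain ⟨d, hd⟩ := hD
  have hdA : d ∈ A \ B := hCD ▸ Set.mem_union_right C hd
  refine Set.disjoint_left.mp hdisj
    (hG.mem_of_neighbors_subset hlt hC ?_ ?_ (v := d) fun h => hdA.2 h.1.2) hd
  · exact Set.disjoint_left.mpr fun c hc h => (hCA hc).2 h.1.2
  · intro c hc w hcw
    have hw : w ∈ A ∪ B := hcov ▸ Set.mem_univ w
    by_cases hwA : w ∈ A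
    · by_cases hwB : w ∈ B
      · exact .inr ⟨⟨hwA, hwB⟩, fun h => hno c hc (Set.mem_singleton_iff.mp h ▸ hcw.symm)⟩
      · have : w ∈ C ∪ D := hCD ▸ ⟨hwA, hwB⟩
        exact .inl (this.resolve_right fun h => hadj c hc w h hcw)
    · have : s(c, w) ∈ sepEdges G A B :=
        ⟨hcw, c, w, rfl, hCA hc, hw.resolve_left hwA, hwA⟩
      simp [hedges] at this

theorem KConnected.two_le_encard_neighborSet {G : SimpleGraph V} {k : ℕ} (hG : KConnected G k)
    {A B : Set V} (hAB : IsMixedSep A B) (hord : sepOrder G A B = k)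
    (hA : ¬ (G.induce (A \ B)).Connected) {v : V} (hv : v ∈ A ∩ B) :
    2 ≤ (G.neighborSet v ∩ (A \ B)).encard := by
  have hedges := hG.sepEdges_eq_empty hAB hord hA
  obtain ⟨C, D, hC, hD, hCD, hdisj, hadj⟩ := exists_split_of_not_connected_s17 hAB.2.1 hA
  obtain ⟨c, hc, hvc⟩ := hG.exists_adj_of_split hAB.1 hord hedges hC hD hCD hdisj hadj hv
  obtain ⟨d, hd, hvd⟩ := hG.exists_adj_of_split hAB.1 hord hedges hD hC
    (Set.union_comm C D ▸ hCD) hdisj.symm (fun d hd c hc hdc => hadj c hc d hd hdc.symm) hv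
  have hne : c ≠ d := fun h => Set.disjoint_left.mp hdisj hc (h ▸ hd)
  rw [← Set.encard_pair hne, ← hCD]
  refine Set.encard_le_encard ?_
  rintro _ (rfl | rfl)
  · exact ⟨hvc, .inl hc⟩
  · exact ⟨hvd, .inr hd⟩

/-- a mixed-4-separation that is not half-connected is a
tetra-separation. -/
theorem not_half_connected_is_tetra (G : SimpleGraph V) (A B : Set V)
    (hG : KConnected G 4) (hAB : IsMixedSep A B) (hord : sepOrder G A B = 4)
    (hnothalf : ¬ HalfConnected G A B) :
    IsTetraSep G A B := by
  rw [HalfConnected, not_or] at hnothalf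
  obtain ⟨hA, hB⟩ := hnothalf
  refine ⟨hAB, hord, fun v hv => ⟨hG.two_le_encard_neighborSet hAB hord hA hv, ?_⟩, ?_⟩
  · exact hG.two_le_encard_neighborSet ⟨Set.union_comm A B ▸ hAB.1, hAB.2.2, hAB.2.1⟩
      (sepOrder_comm G A B ▸ hord) hB hv.symm
  · intro e he
    simp [hG.sepEdges_eq_empty hAB hord hA] at he
end Paper
end

section
/- Let (A,B) be a 4-separation in a 4-connected graph G such that |A \ B| ≥ 2 and every vertex in S(A,B) has at least 2 neighbours in B \ A. Let (A'',B'') be the left-right-reduction of (A,B). Then no tetra-separation (C,D) of G satisfies (A'',B'') < (C,D) ≤ (A,B). -/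
open Set

namespace Paper

variable {V : Type*}

/-- no tetra-separation strictly between a 4-separation and its
left-right-reduction. -/
theorem squeezing_tetra (G : SimpleGraph V) (A B : Set V)
    (hG : KConnected G 4)
    (hAB : IsMixedSep A B) (hnoedge : sepEdges G A B = ∅)
    (hord : sepOrder G A B = 4)
    (hbig : 2 ≤ (A \ B).encard)
    (hdeg : ∀ v ∈ A ∩ B, 2 ≤ (G.neighborSet v ∩ (B \ A)).encard) :
    ∀ C D : Set V, IsTetraSep G C D →
      ¬ ((LeSep (leftRed G A B) (leftRed G B (leftRed G A B)) C D ∧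
            ¬ (leftRed G A B = C ∧ leftRed G B (leftRed G A B) = D)) ∧
          LeSep C D A B) := by
  rintro C D ⟨-, -, hdegCD, -⟩ ⟨⟨⟨hAC, hDB⟩, hne⟩, hCA, hBD⟩
  have hred : leftRed G B (leftRed G A B) ⊆ B := Set.sdiff_subset
  have hD : D = B := (hDB.trans hred).antisymm hBD
  subst hD
  refine hne ⟨hAC.antisymm fun v hv => ⟨hCA hv, ?_⟩, hred.antisymm hDB⟩
  rintro ⟨⟨-, hvD⟩, hle⟩
  have hsub : C \ D ⊆ A \ D := Set.sdiff_subset_sdiff_left hCA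
  have h2 : (2 : ℕ∞) ≤ 1 := (hdegCD v ⟨hv, hvD⟩).1.trans
    ((Set.encard_le_encard (Set.inter_subset_inter_right _ hsub)).trans hle)
  exact absurd h2 (by decide)
end Paper
end
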